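/- Fix positive integers k and b and a (deterministic) level assignment ℓ_1,…,ℓ_n ∈ {1,2,3,…} such that for every level ℓ ≥ 1, C_{ℓ, min(2^ℓ·b, n)} < k. Let f_1 ≥ … ≥ f_n ≥ 0 with F = ∑_{i=1}^n f_i, and define I_i = 1 if C_{ℓ_i,i-1} < k and 0 otherwise, and p_i = ∑_{ℓ ≥ 1 : C_{ℓ,i-1} < k} 2^{-ℓ}. Then for every i ∈ {1,…,n}, |(I_i/p_i − 1)·f_i| ≤ F/b. -/

import Mathlib

/-- `levelCount n L ℓ i` is `C_{ℓ,i}`: the number of points among the first `i`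
(i.e. those `j : Fin n` with `(j : ℕ) < i`) assigned to level `ℓ` by `L`. -/
def levelCount (n : ℕ) (L : Fin n → ℕ) (ℓ : ℕ) (i : ℕ) : ℕ :=
  (Finset.univ.filter (fun j : Fin n => (j : ℕ) < i ∧ L j = ℓ)).card

/-- `pVal n k L m` is `p_i` for the point with `m = i − 1` previous points:
`∑_{ℓ ≥ 1 : C_{ℓ,m} < k} 2^{−ℓ}` (the sum over levels `ℓ ≥ 1` is written as a
`tsum` over `ℓ : ℕ` of the term at level `ℓ + 1`). -/
noncomputable def pVal (n k : ℕ) (L : Fin n → ℕ) (m : ℕ) : ℝ :=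
  ∑' ℓ : ℕ, if levelCount n L (ℓ + 1) m < k then (1 / 2 : ℝ) ^ (ℓ + 1) else 0

/-- `IVal n k L i` is the indicator `I_i = 1[C_{ℓ_i, i−1} < k]` for the point `i : Fin n`
(0-based, so it has `(i : ℕ)` previous points). -/
noncomputable def IVal (n k : ℕ) (L : Fin n → ℕ) (i : Fin n) : ℝ :=
  if levelCount n L (L i) (i : ℕ) < k then 1 else 0

lemma levelCount_mono {n : ℕ} (L : Fin n → ℕ) (ℓ : ℕ) : Monotone (levelCount n L ℓ) := by
  intro i j hij
  refine Finset.card_le_card fun x hx => ?_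
  simp only [Finset.mem_filter, Finset.mem_univ, true_and] at hx ⊢
  exact ⟨hx.1.trans_le hij, hx.2⟩

lemma summable_half_pow_succ : Summable fun ℓ : ℕ => (1 / 2 : ℝ) ^ (ℓ + 1) :=
  (summable_nat_add_iff 1).2 summable_geometric_two

lemma tsum_half_pow_succ : ∑' ℓ : ℕ, (1 / 2 : ℝ) ^ (ℓ + 1) = 1 := by
  simp_rw [pow_succ]
  rw [tsum_mul_right, tsum_geometric_two]
  norm_num

lemma summable_pVal (n k : ℕ) (L : Fin n → ℕ) (m : ℕ) :
    Summable fun ℓ : ℕ =>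
      if levelCount n L (ℓ + 1) m < k then (1 / 2 : ℝ) ^ (ℓ + 1) else 0 := by
  refine summable_half_pow_succ.of_nonneg_of_le (fun ℓ => ?_) (fun ℓ => ?_) <;> split_ifs <;>
    first | positivity | rfl

lemma pVal_le_one (n k : ℕ) (L : Fin n → ℕ) (m : ℕ) : pVal n k L m ≤ 1 := by
  rw [← tsum_half_pow_succ]
  refine (summable_pVal n k L m).tsum_le_tsum (fun ℓ => ?_) summable_half_pow_succ
  split_ifs <;> first | positivity | rfl

/-- If all levels above `t` are open, then `pVal` is at least their total mass `2 ^ (-t)`. -/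
lemma half_pow_le_pVal {n k : ℕ} {L : Fin n → ℕ} {m t : ℕ}
    (h : ∀ ℓ, t < ℓ → levelCount n L ℓ m < k) : (1 / 2 : ℝ) ^ t ≤ pVal n k L m := by
  rw [pVal, ← (summable_pVal n k L m).sum_add_tsum_nat_add t]
  have htail : ∑' ℓ : ℕ, (if levelCount n L (ℓ + t + 1) m < k then
      (1 / 2 : ℝ) ^ (ℓ + t + 1) else 0) = (1 / 2 : ℝ) ^ t := by
    have hterm : ∀ ℓ : ℕ, (if levelCount n L (ℓ + t + 1) m < k then
        (1 / 2 : ℝ) ^ (ℓ + t + 1) else 0) = (1 / 2 : ℝ) ^ t * (1 / 2 : ℝ) ^ (ℓ + 1) := by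
      intro ℓ
      rw [if_pos (h _ (by omega))]
      ring
    simp_rw [hterm]
    rw [tsum_mul_left, tsum_half_pow_succ, mul_one]
  rw [htail]
  refine le_add_of_nonneg_left (Finset.sum_nonneg fun ℓ _ => ?_)
  split_ifs <;> positivity

lemma succ_mul_le_sum {n : ℕ} {f : Fin n → ℝ} (hmono : ∀ i j : Fin n, i ≤ j → f j ≤ f i)
    (hf : ∀ i, 0 ≤ f i) (i : Fin n) : ((i : ℕ) + 1 : ℝ) * f i ≤ ∑ j, f j := by
  calc ((i : ℕ) + 1 : ℝ) * f i = ∑ _j ∈ Finset.Iic i, f i := by simp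
    _ ≤ ∑ j ∈ Finset.Iic i, f j :=
      Finset.sum_le_sum fun j hj => hmono j i (Finset.mem_Iic.1 hj)
    _ ≤ ∑ j, f j :=
      Finset.sum_le_sum_of_subset_of_nonneg (Finset.subset_univ _) fun j _ _ => hf j

/-- If all levels above `t` are open, then the relative error is at most `2 ^ t`. -/
lemma abs_IVal_div_pVal_sub_one_le {n k : ℕ} {L : Fin n → ℕ} (i : Fin n) {t : ℕ}
    (h : ∀ ℓ, t < ℓ → levelCount n L ℓ (i : ℕ) < k) :
    |IVal n k L i / pVal n k L (i : ℕ) - 1| ≤ 2 ^ t := by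
  have hp := half_pow_le_pVal h
  have hp0 : 0 < pVal n k L (i : ℕ) := lt_of_lt_of_le (by positivity) hp
  have hp1 := pVal_le_one n k L (i : ℕ)
  have hinv : 1 / pVal n k L (i : ℕ) ≤ 2 ^ t := by
    have := one_div_le_one_div_of_le (by positivity) hp
    simpa using this
  have hinv1 : 1 ≤ 1 / pVal n k L (i : ℕ) := (one_le_div hp0).2 hp1
  unfold IVal
  split_ifs
  · rw [abs_of_nonneg (by linarith)]
    linarith
  · simpa using one_le_pow₀ (M₀ := ℝ) one_le_two

/-- Fix positive integers `k` and `b` and a deterministic level assignment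
`ℓ_1,…,ℓ_n ∈ {1,2,3,…}` such that for every level `ℓ ≥ 1`, `C_{ℓ, min(2^ℓ·b, n)} < k`.
Let `f_1 ≥ … ≥ f_n ≥ 0` with `F = ∑ f_i`, and define `I_i` and `p_i` as above.
Then for every `i ∈ {1,…,n}`, `|(I_i/p_i − 1)·f_i| ≤ F/b`. -/
theorem stmt_10 (n k b : ℕ) (hk : 0 < k) (hb : 0 < b)
    (L : Fin n → ℕ) (hL : ∀ j, 1 ≤ L j)
    (hgood : ∀ ℓ : ℕ, 1 ≤ ℓ → levelCount n L ℓ (min (2 ^ ℓ * b) n) < k)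
    (f : Fin n → ℝ) (hmono : ∀ i j : Fin n, i ≤ j → f j ≤ f i) (hf : ∀ i, 0 ≤ f i) :
    ∀ i : Fin n,
      |(IVal n k L i / pVal n k L (i : ℕ) - 1) * f i| ≤ (∑ j, f j) / (b : ℝ) := by
  intro i
  have hbR : (0 : ℝ) < b := by exact_mod_cast hb
  have hF : 0 ≤ ∑ j, f j := Finset.sum_nonneg fun j _ => hf j
  have hopen : ∀ ℓ, 1 ≤ ℓ → (i : ℕ) ≤ 2 ^ ℓ * b → levelCount n L ℓ (i : ℕ) < k :=
    fun ℓ hℓ hi => (levelCount_mono L ℓ (le_min hi i.2.le)).trans_lt (hgood ℓ hℓ)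
  have hex : ∃ t, ∀ ℓ, t < ℓ → levelCount n L ℓ (i : ℕ) < k := by
    refine ⟨i, fun ℓ hℓ => hopen ℓ (by omega) ?_⟩
    exact (hℓ.trans Nat.lt_two_pow_self).le.trans (Nat.le_mul_of_pos_right _ hb)
  classical
  obtain ⟨t, ht, hmin⟩ : ∃ t, (∀ ℓ, t < ℓ → levelCount n L ℓ (i : ℕ) < k) ∧
      ∀ s < t, ¬ ∀ ℓ, s < ℓ → levelCount n L ℓ (i : ℕ) < k :=
    ⟨Nat.find hex, Nat.find_spec hex, fun s hs => Nat.find_min hex hs⟩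
  rcases Nat.eq_zero_or_pos t with rfl | htpos
  · have hI : IVal n k L i = 1 := if_pos (ht _ (hL i))
    have hp : pVal n k L (i : ℕ) = 1 :=
      le_antisymm (pVal_le_one n k L i) (by simpa using half_pow_le_pVal ht)
    rw [hI, hp]
    simpa using div_nonneg hF hbR.le
  · have hlt : 2 ^ t * b < (i : ℕ) := by
      by_contra! hle
      refine hmin (t - 1) (by omega) fun ℓ hℓ => ?_
      rcases (show t ≤ ℓ by omega).eq_or_lt with rfl | hlt
      · exact hopen _ htpos hle
      · exact ht ℓ hlt
    have hltR : (2 : ℝ) ^ t * b ≤ (i : ℕ) + 1 := by exact_mod_cast hlt.le.trans (Nat.le_succ _)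
    rw [abs_mul, abs_of_nonneg (hf i), le_div_iff₀ hbR]
    calc |IVal n k L i / pVal n k L (i : ℕ) - 1| * f i * b ≤ 2 ^ t * f i * b := by
          gcongr
          · exact hf i
          · exact abs_IVal_div_pVal_sub_one_le i ht
      _ = 2 ^ t * b * f i := by ring
      _ ≤ ((i : ℕ) + 1) * f i := by
          gcongr
          exact hf i
      _ ≤ ∑ j, f j := succ_mul_le_sum hmono hf i
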